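/- (Theorem 3.1, second bound, explicit constants.) Let A = M + K with A and M invertible n×n real matrices, b ∈ ℝⁿ with b ≠ 0, x := A⁻¹b, B := I + M⁻¹K, and c := M⁻¹b. Let ε ≥ 0 and suppose: E is an n×n matrix with ‖E‖ ≤ ε·(1 + ‖M⁻¹‖·‖K‖) and B̂ := B + E; ĉ ∈ ℝⁿ satisfies ‖ĉ − c‖ ≤ ε·‖M⁻¹‖·‖b‖; F is an n×n matrix with ‖F‖ ≤ ε·‖B̂‖; x̂ ∈ ℝⁿ satisfies (B̂ + F)x̂ = ĉ; δ := (‖E‖ + ‖F‖)·‖B⁻¹‖ < 1; and in addition ‖M⁻¹‖·‖K‖ < 1. Then ‖x̂ − x‖ ≤ 10ε / ((1 − δ)·(1 − ‖M⁻¹‖·‖K‖)²) · ‖A⁻¹‖·‖b‖, i.e. the computed solution x̂ has inverse-equivalent accuracy whenever ‖M⁻¹‖‖K‖ is bounded away from 1. -/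

import Mathlib

open Matrix

/-- Euclidean norm of a vector in `ℝⁿ`. -/
noncomputable def vnorm {n : ℕ} (v : Fin n → ℝ) : ℝ :=
  ‖(WithLp.equiv 2 (Fin n → ℝ)).symm v‖

/-- Operator norm (spectral norm) of a matrix, induced by the Euclidean norm. -/
noncomputable def opnorm {n : ℕ} (A : Matrix (Fin n) (Fin n) ℝ) : ℝ :=
  ‖Matrix.toEuclideanCLM (𝕜 := ℝ) A‖

/-- Condition number `κ(A) = ‖A‖·‖A⁻¹‖` with respect to the spectral norm. -/
noncomputable def condNum {n : ℕ} (A : Matrix (Fin n) (Fin n) ℝ) : ℝ :=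
  opnorm A * opnorm A⁻¹

theorem opnorm_nonneg {n : ℕ} (X : Matrix (Fin n) (Fin n) ℝ) : 0 ≤ opnorm X := norm_nonneg _

theorem opnorm_one_le {n : ℕ} : opnorm (1 : Matrix (Fin n) (Fin n) ℝ) ≤ 1 := by
  unfold opnorm
  rw [map_one]
  exact ContinuousLinearMap.norm_id_le

theorem opnorm_mul_le {n : ℕ} (X Y : Matrix (Fin n) (Fin n) ℝ) :
    opnorm (X * Y) ≤ opnorm X * opnorm Y := by
  unfold opnorm
  rw [map_mul]
  exact norm_mul_le _ _

theorem opnorm_add_le {n : ℕ} (X Y : Matrix (Fin n) (Fin n) ℝ) :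
    opnorm (X + Y) ≤ opnorm X + opnorm Y := by
  unfold opnorm
  rw [map_add]
  exact norm_add_le _ _

theorem opnorm_sub_le {n : ℕ} (X Y : Matrix (Fin n) (Fin n) ℝ) :
    opnorm (X - Y) ≤ opnorm X + opnorm Y := by
  unfold opnorm
  rw [map_sub]
  exact norm_sub_le _ _

theorem vnorm_nonneg {n : ℕ} (v : Fin n → ℝ) : 0 ≤ vnorm v := norm_nonneg _

theorem vnorm_sub_le {n : ℕ} (v w : Fin n → ℝ) : vnorm (v - w) ≤ vnorm v + vnorm w :=
  norm_sub_le (WithLp.toLp 2 v) (WithLp.toLp 2 w)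

theorem vnorm_mulVec_le {n : ℕ} (X : Matrix (Fin n) (Fin n) ℝ) (v : Fin n → ℝ) :
    vnorm (X *ᵥ v) ≤ opnorm X * vnorm v :=
  (Matrix.toEuclideanCLM (𝕜 := ℝ) X).le_opNorm (WithLp.toLp 2 v)

/-- Neumann-type bound on the inverse of a perturbation of the identity. -/
theorem opnorm_inv_one_add_mul_le {n : ℕ} {X : Matrix (Fin n) (Fin n) ℝ} {t : ℝ}
    (hX : opnorm X ≤ t) (hunit : IsUnit (1 + X)) :
    opnorm (1 + X)⁻¹ * (1 - t) ≤ 1 := by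
  have hdet := (Matrix.isUnit_iff_isUnit_det _).mp hunit
  have key : (1 + X)⁻¹ = 1 - X * (1 + X)⁻¹ := by
    have h := Matrix.mul_nonsing_inv _ hdet
    rw [add_mul, one_mul] at h
    exact eq_sub_of_add_eq h
  have h1 : opnorm (1 + X)⁻¹ ≤ 1 + opnorm X * opnorm (1 + X)⁻¹ := by
    conv_lhs => rw [key]
    exact (opnorm_sub_le _ _).trans (add_le_add opnorm_one_le (opnorm_mul_le _ _))
  nlinarith [mul_le_mul_of_nonneg_right hX (opnorm_nonneg (1 + X)⁻¹)]

/-- Normwise perturbation bound for a linear system, in terms of the exact solution. -/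
theorem vnorm_sub_le_of_perturbed_system {n : ℕ} {B G : Matrix (Fin n) (Fin n) ℝ}
    {x y c d : Fin n → ℝ} (hB : IsUnit B) (hx : B *ᵥ x = c) (hy : (B + G) *ᵥ y = d) :
    (1 - opnorm G * opnorm B⁻¹) * vnorm (y - x) ≤
      opnorm B⁻¹ * (vnorm (d - c) + opnorm G * vnorm x) := by
  have hdet := (Matrix.isUnit_iff_isUnit_det _).mp hB
  have h : y - x = B⁻¹ *ᵥ (d - c - G *ᵥ x - G *ᵥ (y - x)) := by
    have h2 : d - c - G *ᵥ x - G *ᵥ (y - x) = B *ᵥ (y - x) := by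
      rw [← hx, ← hy, add_mulVec, mulVec_sub, mulVec_sub]
      abel
    rw [h2, mulVec_mulVec, Matrix.nonsing_inv_mul _ hdet, one_mulVec]
  have h1 : vnorm (y - x) ≤
      opnorm B⁻¹ * (vnorm (d - c) + opnorm G * vnorm x + opnorm G * vnorm (y - x)) := by
    conv_lhs => rw [h]
    refine (vnorm_mulVec_le _ _).trans (mul_le_mul_of_nonneg_left ?_ (opnorm_nonneg _))
    linarith [vnorm_sub_le (d - c - G *ᵥ x) (G *ᵥ (y - x)), vnorm_sub_le (d - c) (G *ᵥ x),
      vnorm_mulVec_le G x, vnorm_mulVec_le G (y - x)]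
  linarith

theorem stmt11 {n : ℕ} (M K A : Matrix (Fin n) (Fin n) ℝ)
    (hM : IsUnit M) (hAdef : A = M + K) (hA : IsUnit A)
    (b : Fin n → ℝ) (hb : b ≠ 0)
    (x : Fin n → ℝ) (hx : x = A⁻¹.mulVec b)
    (B : Matrix (Fin n) (Fin n) ℝ) (hBdef : B = 1 + M⁻¹ * K)
    (c : Fin n → ℝ) (hc : c = M⁻¹.mulVec b)
    (ε : ℝ) (hε : 0 ≤ ε)
    (E : Matrix (Fin n) (Fin n) ℝ)
    (hE : opnorm E ≤ ε * (1 + opnorm M⁻¹ * opnorm K))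
    (Bhat : Matrix (Fin n) (Fin n) ℝ) (hBhat : Bhat = B + E)
    (chat : Fin n → ℝ) (hchat : vnorm (chat - c) ≤ ε * opnorm M⁻¹ * vnorm b)
    (F : Matrix (Fin n) (Fin n) ℝ) (hF : opnorm F ≤ ε * opnorm Bhat)
    (xhat : Fin n → ℝ) (hxhat : (Bhat + F).mulVec xhat = chat)
    (δ : ℝ) (hδ : δ = (opnorm E + opnorm F) * opnorm B⁻¹) (hδ1 : δ < 1)
    (hMK : opnorm M⁻¹ * opnorm K < 1) :
    vnorm (xhat - x) ≤
      10 * ε / ((1 - δ) * (1 - opnorm M⁻¹ * opnorm K) ^ 2) *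
        (opnorm A⁻¹ * vnorm b) := by
  have hMdet := (Matrix.isUnit_iff_isUnit_det _).mp hM
  have hAdet := (Matrix.isUnit_iff_isUnit_det _).mp hA
  have hBA : B = M⁻¹ * A := by
    rw [hBdef, hAdef, mul_add, Matrix.nonsing_inv_mul _ hMdet]
  have hB : IsUnit B := by
    rw [hBA]
    exact ((Matrix.isUnit_nonsing_inv_iff).mpr hM).mul hA
  have hBdet := (Matrix.isUnit_iff_isUnit_det _).mp hB
  have hBx : B *ᵥ x = c := by
    rw [hx, hc, mulVec_mulVec, hBA, mul_assoc, Matrix.mul_nonsing_inv _ hAdet, mul_one]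
  have hMinv : M⁻¹ = B * A⁻¹ := by
    rw [hBA, mul_assoc, Matrix.mul_nonsing_inv _ hAdet, mul_one]
  have hpert := vnorm_sub_le_of_perturbed_system (G := E + F) (y := xhat) (d := chat) hB hBx
    (by rw [← add_assoc, ← hBhat]; exact hxhat)
  have hBinv : opnorm B⁻¹ * (1 - opnorm M⁻¹ * opnorm K) ≤ 1 := by
    rw [hBdef] at hB ⊢
    exact opnorm_inv_one_add_mul_le (opnorm_mul_le _ _) hB
  have hBnorm : opnorm B ≤ 1 + opnorm M⁻¹ * opnorm K := by
    rw [hBdef]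
    exact (opnorm_add_le _ _).trans (add_le_add opnorm_one_le (opnorm_mul_le _ _))
  have hMnorm : opnorm M⁻¹ ≤ opnorm B * opnorm A⁻¹ := by
    conv_lhs => rw [hMinv]
    exact opnorm_mul_le _ _
  have hxnorm : vnorm x ≤ opnorm A⁻¹ * vnorm b := hx ▸ vnorm_mulVec_le _ _
  have ht : 0 ≤ opnorm M⁻¹ * opnorm K := mul_nonneg (opnorm_nonneg _) (opnorm_nonneg _)
  generalize opnorm M⁻¹ * opnorm K = t at *
  have hB2 : opnorm B ≤ 2 := by linarith
  have hE2 : opnorm E ≤ 2 := by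
    have hEB : opnorm E ≤ opnorm E * opnorm B⁻¹ * opnorm B := by
      conv_lhs => rw [← mul_one E, ← Matrix.nonsing_inv_mul _ hBdet, ← mul_assoc]
      exact (opnorm_mul_le _ _).trans
        (mul_le_mul_of_nonneg_right (opnorm_mul_le _ _) (opnorm_nonneg _))
    have hEB1 : opnorm E * opnorm B⁻¹ ≤ 1 := by
      linarith [mul_nonneg (opnorm_nonneg F) (opnorm_nonneg B⁻¹)]
    linarith [mul_le_mul_of_nonneg_right hEB1 (opnorm_nonneg B)]
  have hEε : opnorm E ≤ 2 * ε := by nlinarith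
  have hFε : opnorm F ≤ 4 * ε := by
    have : opnorm Bhat ≤ 4 := by
      rw [hBhat]
      linarith [opnorm_add_le B E]
    nlinarith
  have hEF : opnorm (E + F) ≤ opnorm E + opnorm F := opnorm_add_le _ _
  have hb0 := vnorm_nonneg b
  have ha0 := opnorm_nonneg A⁻¹
  have hp0 := opnorm_nonneg B⁻¹
  have hs0 : 0 ≤ opnorm A⁻¹ * vnorm b := mul_nonneg ha0 hb0
  have hc2 : vnorm (chat - c) ≤ 2 * ε * (opnorm A⁻¹ * vnorm b) := by
    have hM2 : opnorm M⁻¹ ≤ 2 * opnorm A⁻¹ :=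
      hMnorm.trans (mul_le_mul_of_nonneg_right hB2 ha0)
    calc vnorm (chat - c) ≤ ε * opnorm M⁻¹ * vnorm b := hchat
      _ ≤ ε * (2 * opnorm A⁻¹) * vnorm b := by gcongr
      _ = 2 * ε * (opnorm A⁻¹ * vnorm b) := by ring
  have hGx : opnorm (E + F) * vnorm x ≤ 6 * ε * (opnorm A⁻¹ * vnorm b) :=
    mul_le_mul (by linarith) hxnorm (vnorm_nonneg _) (by positivity)
  have hmain : (1 - δ) * vnorm (xhat - x) ≤
      opnorm B⁻¹ * (8 * ε * (opnorm A⁻¹ * vnorm b)) := by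
    have hδG : opnorm (E + F) * opnorm B⁻¹ ≤ δ := by
      rw [hδ]
      exact mul_le_mul_of_nonneg_right hEF hp0
    calc (1 - δ) * vnorm (xhat - x)
        ≤ (1 - opnorm (E + F) * opnorm B⁻¹) * vnorm (xhat - x) :=
          mul_le_mul_of_nonneg_right (by linarith) (vnorm_nonneg _)
      _ ≤ _ := hpert
      _ ≤ _ := mul_le_mul_of_nonneg_left (by linarith) hp0
  have h1t : 0 < 1 - t := by linarith
  have h1δ : 0 < 1 - δ := by linarith
  have hp2 : opnorm B⁻¹ * (1 - t) ^ 2 ≤ 1 := by nlinarith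
  have hεs : 0 ≤ ε * (opnorm A⁻¹ * vnorm b) := mul_nonneg hε hs0
  rw [div_mul_eq_mul_div, le_div_iff₀ (by positivity)]
  calc vnorm (xhat - x) * ((1 - δ) * (1 - t) ^ 2)
      = (1 - δ) * vnorm (xhat - x) * (1 - t) ^ 2 := by ring
    _ ≤ opnorm B⁻¹ * (8 * ε * (opnorm A⁻¹ * vnorm b)) * (1 - t) ^ 2 := by gcongr
    _ = opnorm B⁻¹ * (1 - t) ^ 2 * (8 * (ε * (opnorm A⁻¹ * vnorm b))) := by ring
    _ ≤ 1 * (8 * (ε * (opnorm A⁻¹ * vnorm b))) := by gcongr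
    _ ≤ 10 * ε * (opnorm A⁻¹ * vnorm b) := by linarith
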